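/- arXiv:1903.02858 — 3 statements merged into one kernel-verified Lean document; each statement's English description precedes it below -/
import Mathlib

section
/- Let G = (V,E,w) be a finite weighted graph, f : V → ℝ^d with ℝ^d carrying the Euclidean norm, p ≥ 1 a real number, and fix a vertex u ∈ V. Assume f(v) ≠ f(u) for every v with (u,v) ∈ E. Then the map Φ : ℝ^d → ℝ, Φ(x) = (1/p)·Σ_{v : (u,v)∈E} w(u,v)^{p/2} · ‖f(v) − x‖₂^p (real powers in the sense of Real.rpow), is differentiable at x = f(u) with gradient ∇Φ(f(u)) = Σ_{v : (u,v)∈E} w(u,v)^{p/2} · ‖f(v) − f(u)‖₂^{p−2} · (f(u) − f(v)); i.e., the gradient of the differentiable part of the isotropic regularizer with respect to f(u) is the multidimensional isotropic graph p-Laplacian of f at u (up to sign). -/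
open Finset

/-- Away from `a`, the map `x ↦ ‖a - x‖ ^ p` is differentiable, for every real exponent `p`. -/
theorem hasFDerivAt_norm_const_sub_rpow {F : Type*} [NormedAddCommGroup F]
    [InnerProductSpace ℝ F] {a x : F} (h : a ≠ x) (p : ℝ) :
    HasFDerivAt (fun y : F => ‖a - y‖ ^ p) ((p * ‖a - x‖ ^ (p - 2)) • innerSL ℝ (x - a)) x := by
  have hpos : 0 < ‖a - x‖ := norm_pos_iff.2 (sub_ne_zero.2 h)
  have hsub : HasFDerivAt (fun y : F => a - y) (-ContinuousLinearMap.id ℝ F) x :=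
    (hasFDerivAt_id x).const_sub a
  have hpow : HasFDerivAt (fun y : F => (‖a - y‖ ^ 2) ^ (p / 2)) _ x :=
    hsub.norm_sq.rpow_const (p := p / 2) (Or.inl (by positivity))
  have hsq : ∀ (q : ℝ) (y : F), (‖a - y‖ ^ 2) ^ q = ‖a - y‖ ^ (2 * q) := fun q y => by
    rw [← Real.rpow_natCast_mul (norm_nonneg _), Nat.cast_ofNat]
  simp only [hsq] at hpow
  rw [show 2 * (p / 2) = p by ring, show 2 * (p / 2 - 1) = p - 2 by ring] at hpow
  refine hpow.congr_fderiv ?_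
  ext z
  simp
  ring

/-- The gradient of the differentiable part of the isotropic regularizer with respect to
`f(u)` is the multidimensional isotropic graph `p`-Laplacian of `f` at `u` (up to sign). -/
theorem isotropic_regularizer_gradient
    {V : Type*} [Fintype V] [DecidableEq V] (d : ℕ)
    (E : Finset (V × V)) (w : V → V → ℝ)
    (hE_symm : ∀ u v : V, (u, v) ∈ E ↔ (v, u) ∈ E)
    (hE_loop : ∀ u : V, (u, u) ∉ E)
    (hw_symm : ∀ u v : V, w u v = w v u)
    (hw_pos : ∀ u v : V, (u, v) ∈ E → 0 < w u v)
    (hw_zero : ∀ u v : V, (u, v) ∉ E → w u v = 0)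
    (p : ℝ) (hp : 1 ≤ p)
    (f : V → EuclideanSpace ℝ (Fin d))
    (u : V) (hne : ∀ v : V, (u, v) ∈ E → f v ≠ f u)
    (Φ : EuclideanSpace ℝ (Fin d) → ℝ)
    (hΦ : ∀ x : EuclideanSpace ℝ (Fin d), Φ x =
      (1 / p) * ∑ v ∈ Finset.univ.filter (fun v => (u, v) ∈ E),
        w u v ^ (p / 2) * ‖f v - x‖ ^ p) :
    HasGradientAt Φ
      (∑ v ∈ Finset.univ.filter (fun v => (u, v) ∈ E),
        (w u v ^ (p / 2) * ‖f v - f u‖ ^ (p - 2)) • (f u - f v))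
      (f u) := by
  rw [hasGradientAt_iff_hasFDerivAt, funext hΦ]
  have hp0 : p ≠ 0 := by linarith
  have hsum := (HasFDerivAt.fun_sum (u := Finset.univ.filter (fun v => (u, v) ∈ E))
    fun v hv => (hasFDerivAt_norm_const_sub_rpow
      (hne v (Finset.mem_filter.1 hv).2) p).const_mul (w u v ^ (p / 2))).const_mul (1 / p)
  refine hsum.congr_fderiv ?_
  rw [map_sum, Finset.smul_sum]
  refine Finset.sum_congr rfl fun v _ => ?_
  ext z
  simp
  field_simp
end

section
/- Let G = (V,E,w) be a finite weighted graph, π : V → I a surjection encoding a partition of V, c : I → ℝ^d, and f(u) = c(π(u)). Let B ⊆ V and let γ^B, γ^{Bc} : I → ℝ^d satisfy γ^B(A) + γ^{Bc}(A) ≠ 0 for every A ∈ I. Define the perturbed function f̃(u) = c(π(u)) + 1_B(u)·γ^B(π(u)) − 1_{B^c}(u)·γ^{Bc}(π(u)). Assume that for every edge (u,v) ∈ E with π(u) ≠ π(v) one has both f(u) ≠ f(v) and f̃(u) ≠ f̃(v). Then the change in the ℓ₀-type total variation is exactly twice the within-part cut weight: Σ_{(u,v)∈E, f̃(u) ≠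 f̃(v)} w(u,v) − Σ_{(u,v)∈E, f(u) ≠ f(v)} w(u,v) = 2·Σ_{A∈I} w(π⁻¹(A)∩B, π⁻¹(A)∩B^c), where w(X,Y) = Σ_{(u,v)∈E∩(X×Y)} w(u,v). -/
open Finset
open scoped Classical

/-- Summing over the parts of a partition the weight from the part's vertices in `B` to its
vertices outside `B` gives the total weight of the edges inside a part that leave `B`. -/
lemma sum_part_cut_eq {V I : Type*} [DecidableEq V] [Fintype I] [DecidableEq I]
    (E : Finset (V × V)) (w : V → V → ℝ) (π : V → I) (B : Finset V) :
    ∑ A : I, ∑ e ∈ E.filter (fun e => π e.1 = A ∧ e.1 ∈ B ∧ π e.2 = A ∧ e.2 ∉ B), w e.1 e.2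
      = ∑ e ∈ E, if π e.1 = π e.2 ∧ e.1 ∈ B ∧ e.2 ∉ B then w e.1 e.2 else 0 := by
  simp only [sum_filter]
  rw [sum_comm]
  refine sum_congr rfl fun e _ => ?_
  rw [sum_eq_single (π e.1)]
  · exact if_congr (by grind) rfl rfl
  · exact fun A _ hA => if_neg fun h => hA h.1.symm
  · exact fun h => absurd (mem_univ _) h

/-- A sum over a symmetric edge set is unchanged when every edge is reversed. -/
lemma sum_swap_of_symm {V M : Type*} [AddCommMonoid M] (E : Finset (V × V))
    (hE : ∀ u v : V, (u, v) ∈ E ↔ (v, u) ∈ E) (g : V × V → M) :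
    ∑ e ∈ E, g e.swap = ∑ e ∈ E, g e :=
  sum_equiv (Equiv.prodComm V V) (fun e => hE e.1 e.2) fun _ _ => rfl

/-- Inside a part, the perturbed function separates exactly the endpoints lying on different
sides of `B`. -/
lemma perturbed_ne_iff {M : Type*} [AddCommGroup M] {p q : Prop} [Decidable p] [Decidable q]
    {a b b' : M} (h : b + b' ≠ 0) :
    a + (if p then b else 0) - (if ¬p then b' else 0)
        ≠ a + (if q then b else 0) - (if ¬q then b' else 0)
      ↔ (p ∧ ¬q) ∨ (q ∧ ¬p) := by
  have h' : b ≠ -b' := fun hb => h (by rw [hb, neg_add_cancel])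
  by_cases hp : p <;> by_cases hq : q <;>
    simp [hp, hq, sub_eq_add_neg, h', h'.symm]

/-- The change of the `ℓ₀`-type total variation under the binary perturbation induced by
`B` equals exactly twice the within-part cut weight `Σ_A w(π⁻¹(A)∩B, π⁻¹(A)∩Bᶜ)`. -/
theorem l0_tv_change_eq_twice_cut
    {V I : Type*} [Fintype V] [DecidableEq V] [Fintype I] [DecidableEq I]
    (d : ℕ) (E : Finset (V × V)) (w : V → V → ℝ)
    (hE_symm : ∀ u v : V, (u, v) ∈ E ↔ (v, u) ∈ E)
    (hE_loop : ∀ u : V, (u, u) ∉ E)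
    (hw_symm : ∀ u v : V, w u v = w v u)
    (hw_pos : ∀ u v : V, (u, v) ∈ E → 0 < w u v)
    (hw_zero : ∀ u v : V, (u, v) ∉ E → w u v = 0)
    (π : V → I) (hπ : Function.Surjective π)
    (c : I → Fin d → ℝ)
    (f : V → Fin d → ℝ) (hf : ∀ u, f u = c (π u))
    (B : Finset V)
    (γB γBc : I → Fin d → ℝ)
    (hγ : ∀ A : I, γB A + γBc A ≠ 0)
    (ft : V → Fin d → ℝ)
    (hft : ∀ u : V, ft u = c (π u)
      + (if u ∈ B then γB (π u) else 0) - (if u ∉ B then γBc (π u) else 0))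
    (hcross : ∀ e ∈ E, π e.1 ≠ π e.2 → f e.1 ≠ f e.2 ∧ ft e.1 ≠ ft e.2) :
    ∑ e ∈ E.filter (fun e => ft e.1 ≠ ft e.2), w e.1 e.2
        - ∑ e ∈ E.filter (fun e => f e.1 ≠ f e.2), w e.1 e.2
      = 2 * ∑ A : I,
          ∑ e ∈ E.filter (fun e => π e.1 = A ∧ e.1 ∈ B ∧ π e.2 = A ∧ e.2 ∉ B),
            w e.1 e.2 := by
  have hswap := sum_swap_of_symm E hE_symm fun e =>
    if π e.1 = π e.2 ∧ e.1 ∈ B ∧ e.2 ∉ B then w e.1 e.2 else 0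
  have hcut := sum_part_cut_eq E w π B
  have key : ∑ e ∈ E.filter (fun e => ft e.1 ≠ ft e.2), w e.1 e.2
      - ∑ e ∈ E.filter (fun e => f e.1 ≠ f e.2), w e.1 e.2
      = (∑ e ∈ E, if π e.1 = π e.2 ∧ e.1 ∈ B ∧ e.2 ∉ B then w e.1 e.2 else 0)
        + ∑ e ∈ E, if π e.2 = π e.1 ∧ e.2 ∈ B ∧ e.1 ∉ B then w e.2 e.1 else 0 := by
    rw [sum_filter, sum_filter, ← sum_sub_distrib, ← sum_add_distrib]
    refine sum_congr rfl fun e he => ?_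
    rw [hw_symm e.2 e.1]
    by_cases hπe : π e.1 = π e.2
    · have hfe : f e.1 = f e.2 := by rw [hf, hf, hπe]
      have hfte : ft e.1 ≠ ft e.2 ↔ (e.1 ∈ B ∧ e.2 ∉ B) ∨ (e.2 ∈ B ∧ e.1 ∉ B) := by
        rw [hft, hft, hπe]
        exact perturbed_ne_iff (hγ _)
      by_cases h1 : e.1 ∈ B <;> by_cases h2 : e.2 ∈ B <;> simp_all
    · obtain ⟨h1, h2⟩ := hcross e he hπe
      simp [h1, h2, hπe, Ne.symm hπe]
  simp only [Prod.fst_swap, Prod.snd_swap] at hswap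
  rw [key, hswap, ← two_mul, ← hcut]
end

section
/- Let G = (V,E,w) be a finite weighted graph, π : V → I a surjection encoding a partition of V, c : I → ℝ^d, B ⊆ V, and γ^B, γ^{Bc} : I → ℝ^d. Define f̃(u) = c(π(u)) + 1_B(u)·γ^B(π(u)) − 1_{B^c}(u)·γ^{Bc}(π(u)), and let p, q ≥ 1 be real numbers with ‖x‖_q = (Σ_j |x_j|^q)^{1/q} (real powers via Real.rpow). Then the regularizer restricted to within-part edges satisfies Σ_{(u,v)∈E, π(u)=π(v)} w(u,v)^{p/2} · ‖f̃(v) − f̃(u)‖_q^p = 2·Σ_{A∈I} w_p(π⁻¹(A)∩B, π⁻¹(A)∩B^c) · ‖γ^B(A) + γ^{Bc}(A)‖_q^p, where w_p(X,Y) = Σ_{(u,v)∈E∩(X×Y)} w(u,v)^{p/2}. -/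
open Finset
open scoped Classical

/-- The `p`-`q` regularizer restricted to within-part edges of the perturbed function
`f̃ = c∘π + 1_B·γ^B∘π − 1_{Bᶜ}·γ^{Bᶜ}∘π` equals twice the weighted within-part cut weight
times `‖γ^B(A) + γ^{Bᶜ}(A)‖_q^p`. -/
theorem pq_regularizer_within_part_cut
    {V I : Type*} [Fintype V] [DecidableEq V] [Fintype I] [DecidableEq I]
    (d : ℕ) (E : Finset (V × V)) (w : V → V → ℝ)
    (hE_symm : ∀ u v : V, (u, v) ∈ E ↔ (v, u) ∈ E)
    (hE_loop : ∀ u : V, (u, u) ∉ E)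
    (hw_symm : ∀ u v : V, w u v = w v u)
    (hw_pos : ∀ u v : V, (u, v) ∈ E → 0 < w u v)
    (hw_zero : ∀ u v : V, (u, v) ∉ E → w u v = 0)
    (π : V → I) (hπ : Function.Surjective π)
    (c : I → Fin d → ℝ)
    (B : Finset V)
    (γB γBc : I → Fin d → ℝ)
    (ft : V → Fin d → ℝ)
    (hft : ∀ u : V, ft u = c (π u)
      + (if u ∈ B then γB (π u) else 0) - (if u ∉ B then γBc (π u) else 0))
    (p q : ℝ) (hp : 1 ≤ p) (hq : 1 ≤ q)
    (nq : (Fin d → ℝ) → ℝ)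
    (hnq : ∀ x : Fin d → ℝ, nq x = (∑ j, |x j| ^ q) ^ (1 / q)) :
    ∑ e ∈ E.filter (fun e => π e.1 = π e.2), w e.1 e.2 ^ (p / 2) * nq (ft e.2 - ft e.1) ^ p
      = 2 * ∑ A : I,
          (∑ e ∈ E.filter (fun e => π e.1 = A ∧ e.1 ∈ B ∧ π e.2 = A ∧ e.2 ∉ B),
              w e.1 e.2 ^ (p / 2))
            * nq (γB A + γBc A) ^ p := by
  have nq_zero : nq 0 = 0 := by
    have hq0 : q ≠ 0 := by linarith
    simp [hnq, Real.zero_rpow hq0, Real.zero_rpow (inv_ne_zero hq0)]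
  have nq_neg (x : Fin d → ℝ) : nq (-x) = nq x := by simp [hnq]
  have zero_rpow_p : (0 : ℝ) ^ p = 0 := Real.zero_rpow (by linarith)
  let cut : V × V → ℝ := fun e =>
    if π e.1 = π e.2 ∧ e.1 ∈ B ∧ e.2 ∉ B then
      w e.1 e.2 ^ (p / 2) * nq (γB (π e.1) + γBc (π e.1)) ^ p
    else 0
  have summand_eq (e : V × V) :
      (if π e.1 = π e.2 then w e.1 e.2 ^ (p / 2) * nq (ft e.2 - ft e.1) ^ p else 0)
        = cut e + cut e.swap := by
    obtain ⟨u, v⟩ := e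
    by_cases h : π u = π v
    · by_cases hu : u ∈ B <;> by_cases hv : v ∈ B
      · simp [cut, hft, h, hu, hv, nq_zero, zero_rpow_p]
      · have hd : c (π v) - γBc (π v) - (c (π v) + γB (π v))
            = -(γB (π v) + γBc (π v)) := by abel
        simp [cut, hft, h, hu, hv, hd, nq_neg, -neg_add_rev]
      · have hd : c (π v) + γB (π v) - (c (π v) - γBc (π v))
            = γB (π v) + γBc (π v) := by abel
        simp [cut, hft, h, hu, hv, hd, hw_symm v u]
      · simp [cut, hft, h, hu, hv, nq_zero, zero_rpow_p]
    · simp [cut, h, Ne.symm h]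
  have sum_swap : ∑ e ∈ E, cut e.swap = ∑ e ∈ E, cut e :=
    sum_nbij' Prod.swap Prod.swap (fun e he => (hE_symm e.1 e.2).1 he)
      (fun e he => (hE_symm e.1 e.2).1 he) (fun _ _ => rfl) (fun _ _ => rfl) (fun _ _ => rfl)
  have sum_parts : ∑ A : I,
      (∑ e ∈ E.filter (fun e => π e.1 = A ∧ e.1 ∈ B ∧ π e.2 = A ∧ e.2 ∉ B),
        w e.1 e.2 ^ (p / 2)) * nq (γB A + γBc A) ^ p = ∑ e ∈ E, cut e := by
    simp_rw [sum_mul, sum_filter]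
    rw [sum_comm]
    refine sum_congr rfl fun e _ => ?_
    rw [sum_eq_single (π e.1)]
    · refine if_congr ?_ rfl rfl
      grind
    · intro A _ hA
      exact if_neg fun h => hA h.1.symm
    · simp
  rw [sum_parts, sum_filter, sum_congr rfl fun e _ => summand_eq e, sum_add_distrib, sum_swap,
    two_mul]
end
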